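/- Let p, q ∈ ℂ with e^{p} ≠ e^{q}, let N ≥ 1 and let k₁, …, k_N be positive integers. Define μ₁(n,t,y,z) = −i n − i e^{p} t + i(e^{−p} − 2e^{2p}) y − 2 i e^{2p} z, μ_j = (1/j!) ∂_p^{j−1} μ₁ for j ≥ 1, ν₁(n,t,y,z) = i n + i e^{q} t − i(e^{−q} − 2e^{2q}) y + 2 i e^{2q} z, ν_j = (1/j!) ∂_q^{j−1} ν₁, and the Schur-polynomial functions P_j = S_j(μ₁, μ₂, …, μ_j), Q_k = S_k(ν₁, ν₂, …, ν_k). Set m_{ij} = Σ_{σ=0}^{k_i + k_j} (−1)^σ / (−i e^{p} + i e^{q})^{σ+1} · ∂_t^σ( P_{k_i} Q_{k_j} ) for 1 ≤ i,j ≤ N. Then τ = det_{1≤i,j≤N}(m_{ij}) satisfies both equations (E1) and (E2) of the variant bilinear Blaszak–Szum system; consequently u(n) = τ(n+i)τ(n−i)/τ(n)² is a rational (lump) solution of the variant BS lattice. -/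

import Mathlib

/-- Partial derivative in the second ("t") variable. -/
noncomputable def dT (f : ℂ → ℂ → ℂ → ℂ → ℂ) : ℂ → ℂ → ℂ → ℂ → ℂ :=
  fun n t y z => deriv (fun s => f n s y z) t

/-- Partial derivative in the third ("y") variable. -/
noncomputable def dY (f : ℂ → ℂ → ℂ → ℂ → ℂ) : ℂ → ℂ → ℂ → ℂ → ℂ :=
  fun n t y z => deriv (fun s => f n t s z) y

/-- Partial derivative in the fourth ("z") variable. -/
noncomputable def dZ (f : ℂ → ℂ → ℂ → ℂ → ℂ) : ℂ → ℂ → ℂ → ℂ → ℂ :=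
  fun n t y z => deriv (fun s => f n t y s) z

/-- Entire function of four complex variables. -/
def Entire4 (f : ℂ → ℂ → ℂ → ℂ → ℂ) : Prop :=
  Differentiable ℂ (fun p : ℂ × ℂ × ℂ × ℂ => f p.1 p.2.1 p.2.2.1 p.2.2.2)

/-- The variant bilinear Blaszak–Szum system: equations (E1) and (E2) in shift form. -/
def VariantBS (τ : ℂ → ℂ → ℂ → ℂ → ℂ) : Prop :=
  ∀ n t y z : ℂ,
    ((-Complex.I) * (dZ τ (n + Complex.I) t y z * τ n t y z
        - τ (n + Complex.I) t y z * dZ τ n t y z)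
      = dT (dT τ) (n + Complex.I) t y z * τ n t y z
        - 2 * dT τ (n + Complex.I) t y z * dT τ n t y z
        + τ (n + Complex.I) t y z * dT (dT τ) n t y z)
    ∧ ((dT (dZ τ) n t y z - dT (dY τ) n t y z) * τ n t y z
        - dT τ n t y z * (dZ τ n t y z - dY τ n t y z)
      = τ n t y z ^ 2 - τ (n + Complex.I) t y z * τ (n - Complex.I) t y z)

/-- The Schur polynomial `S_k(x₁, x₂, …) = ∑_{l₁+2l₂+⋯+k l_k = k} ∏_j x_j^{l_j}/l_j!`
(evaluated at a complex sequence `x`, indexed from 1). -/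
noncomputable def schur (k : ℕ) (x : ℕ → ℂ) : ℂ :=
  ∑ l ∈ Finset.univ.filter
      (fun l : Fin k → Fin (k + 1) => ∑ j : Fin k, ((j : ℕ) + 1) * (l j : ℕ) = k),
    ∏ j : Fin k, x ((j : ℕ) + 1) ^ (l j : ℕ) / (Nat.factorial (l j : ℕ) : ℂ)

section determinants
open Matrix

theorem Derivation.leibniz_finset_prod {k R ι : Type*} [CommRing k] [CommRing R] [Algebra k R]
    [DecidableEq ι] (D : Derivation k R R) (s : Finset ι) (f : ι → R) :
    D (∏ i ∈ s, f i) = ∑ i ∈ s, D (f i) * ∏ j ∈ s.erase i, f j := by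
  induction s using Finset.induction_on with
  | empty => simp
  | insert a s ha ih =>
    rw [Finset.prod_insert ha, D.leibniz, ih, Finset.sum_insert ha, Finset.erase_insert ha,
      smul_eq_mul, smul_eq_mul, Finset.mul_sum, add_comm, mul_comm]
    congr 1
    refine Finset.sum_congr rfl fun i hi => ?_
    have hia : a ≠ i := fun h => ha (h ▸ hi)
    rw [Finset.erase_insert_of_ne hia, Finset.prod_insert (by simp [ha])]
    ring

/-- The Jacobi formula for a derivation. -/
theorem Derivation.map_det {k R n : Type*} [CommRing k] [CommRing R] [Algebra k R]
    [Fintype n] [DecidableEq n] (D : Derivation k R R) (M : Matrix n n R) :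
    D M.det = (M.adjugate * M.map D).trace := by
  have h : ∀ i, (∑ j, D (M i j) * M.adjugate j i) = (M.updateRow i (fun j => D (M i j))).det := by
    intro i
    rw [← cramer_transpose_apply, cramer_eq_adjugate_mulVec, mulVec, dotProduct,
      ← adjugate_transpose]
    simp [mul_comm]
  have h2 : (M.adjugate * M.map D).trace = ∑ i, ∑ j, D (M i j) * M.adjugate j i := by
    rw [Matrix.trace, Finset.sum_comm]
    simp [Matrix.mul_apply, mul_comm]
  rw [h2, Finset.sum_congr rfl fun i _ => h i, ← det_transpose]
  simp_rw [← det_transpose (updateRow _ _ _)]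
  simp only [det_apply, transpose_apply, map_sum]
  rw [Finset.sum_comm]
  refine Finset.sum_congr rfl fun σ _ => ?_
  rw [← Finset.smul_sum, Units.smul_def, Units.smul_def, map_zsmul, D.leibniz_finset_prod]
  congr 1
  refine Finset.sum_congr rfl fun i _ => ?_
  rw [← Finset.mul_prod_erase _ _ (Finset.mem_univ i), updateRow_self]
  congr 1
  refine Finset.prod_congr rfl fun j hj => ?_
  rw [updateRow_ne (Finset.ne_of_mem_erase hj)]

section bordered
variable {k R n : Type*} [CommRing k] [CommRing R] [Algebra k R] [Fintype n] [DecidableEq n]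

/-- The bilinear form `vᵀ adj(M) u`. -/
def adjForm (M : Matrix n n R) (u v : n → R) : R := v ⬝ᵥ (M.adjugate *ᵥ u)

theorem adjForm_sub_left (M : Matrix n n R) (u u' v : n → R) :
    adjForm M (u - u') v = adjForm M u v - adjForm M u' v := by
  simp [adjForm, mulVec_sub]

theorem adjForm_sub_right (M : Matrix n n R) (u v v' : n → R) :
    adjForm M u (v - v') = adjForm M u v - adjForm M u v' := by
  simp [adjForm, sub_dotProduct]

theorem adjForm_smul_left (M : Matrix n n R) (c : R) (u v : n → R) :
    adjForm M (c • u) v = c * adjForm M u v := by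
  simp [adjForm, mulVec_smul]

theorem adjForm_smul_right (M : Matrix n n R) (c : R) (u v : n → R) :
    adjForm M u (c • v) = c * adjForm M u v := by
  simp [adjForm]

theorem adjForm_zero_left (M : Matrix n n R) (v : n → R) : adjForm M 0 v = 0 := by
  simp [adjForm]

theorem adjForm_eq_sum (M : Matrix n n R) (u v : n → R) :
    adjForm M u v = ∑ i, ∑ j, v i * (M.adjugate i j * u j) := by
  simp [adjForm, dotProduct, mulVec, Finset.mul_sum]

theorem trace_adjugate_mul_vecMulVec (M : Matrix n n R) (u v : n → R) :
    (M.adjugate * vecMulVec u v).trace = adjForm M u v := by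
  rw [mul_vecMulVec, trace_vecMulVec, adjForm, dotProduct_comm]

theorem det_mul_derivation_adjugate (D : Derivation k R R) (M : Matrix n n R) :
    M.det • M.adjugate.map D = D M.det • M.adjugate - M.adjugate * M.map D * M.adjugate := by
  have h1 : M.map D * M.adjugate + M * M.adjugate.map D = D M.det • 1 := by
    have := congrArg (fun A => A.map D) M.mul_adjugate
    ext i j
    have h := congrFun (congrFun this i) j
    simp only [map_apply, Matrix.mul_apply, map_sum, D.leibniz, smul_eq_mul, Matrix.smul_apply] at h
    rw [Matrix.add_apply, Matrix.mul_apply, Matrix.mul_apply, ← Finset.sum_add_distrib]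
    rw [Matrix.smul_apply, smul_eq_mul]
    have h1 : D ((1 : Matrix n n R) i j) = 0 := by
      rw [Matrix.one_apply]
      split_ifs <;> simp
    rw [h1, mul_zero, zero_add] at h
    rw [mul_comm, ← h]
    exact Finset.sum_congr rfl fun x _ => by rw [map_apply, map_apply]; ring
  have h2 := congrArg (fun A => M.adjugate * A) h1
  simp only [Matrix.mul_add, ← Matrix.mul_assoc, adjugate_mul, Matrix.mul_smul, Matrix.mul_one,
    Matrix.smul_mul, Matrix.one_mul] at h2
  rw [← h2]; abel

theorem det_mul_derivation_adjForm (D : Derivation k R R) (M : Matrix n n R)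
    (u v : n → R) :
    M.det * D (adjForm M u v) = D M.det * adjForm M u v + M.det * adjForm M (D ∘ u) v
      + M.det * adjForm M u (D ∘ v) - v ⬝ᵥ ((M.adjugate * M.map D * M.adjugate) *ᵥ u) := by
  have h := det_mul_derivation_adjugate D M
  have h1 : D (adjForm M u v) = adjForm M (D ∘ u) v + adjForm M u (D ∘ v)
      + v ⬝ᵥ (M.adjugate.map D *ᵥ u) := by
    rw [adjForm_eq_sum, adjForm_eq_sum, adjForm_eq_sum]
    simp only [dotProduct, mulVec, Finset.mul_sum, map_sum, D.leibniz, smul_eq_mul,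
      Function.comp_apply, map_apply, ← Finset.sum_add_distrib]
    exact Finset.sum_congr rfl fun i _ => Finset.sum_congr rfl fun j _ => by ring
  have h2 : M.det * (v ⬝ᵥ (M.adjugate.map D *ᵥ u)) = D M.det * adjForm M u v -
      v ⬝ᵥ ((M.adjugate * M.map D * M.adjugate) *ᵥ u) := by
    rw [← smul_eq_mul, ← dotProduct_smul, ← smul_mulVec, h, sub_mulVec, dotProduct_sub,
      smul_mulVec, dotProduct_smul, smul_eq_mul, adjForm]
  rw [h1, mul_add, h2]; ring

theorem adjForm_conj_vecMulVec (M : Matrix n n R) (u v w s : n → R) :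
    v ⬝ᵥ ((M.adjugate * vecMulVec w s * M.adjugate) *ᵥ u) = adjForm M w v * adjForm M u s := by
  rw [mul_vecMulVec, vecMulVec_mul, vecMulVec_mulVec]
  simp only [adjForm, dotProduct_mulVec, dotProduct_smul, MulOpposite.smul_eq_mul_unop]
  simp

/-- Derivative of the determinant when `D M` is a rank-two perturbation of a multiple of `M`. -/
theorem derivation_det_of_rank_two (D : Derivation k R R) (M : Matrix n n R) (e : R)
    (w₁ s₁ w₂ s₂ : n → R) (h : M.map D = vecMulVec w₁ s₁ + vecMulVec w₂ s₂ + e • M) :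
    D M.det = adjForm M w₁ s₁ + adjForm M w₂ s₂ + Fintype.card n * e * M.det := by
  rw [D.map_det, h, Matrix.mul_add, Matrix.mul_add, trace_add, trace_add,
    trace_adjugate_mul_vecMulVec, trace_adjugate_mul_vecMulVec, Matrix.mul_smul, adjugate_mul,
    trace_smul, trace_smul, trace_one]
  simp only [smul_eq_mul]; ring

/-- Derivative of the adjugate form when `D M` is a rank-two perturbation of a multiple of `M`. -/
theorem derivation_adjForm_of_rank_two (D : Derivation k R R) (M : Matrix n n R)
    (e : R) (w₁ s₁ w₂ s₂ : n → R)
    (h : M.map D = vecMulVec w₁ s₁ + vecMulVec w₂ s₂ + e • M) (u v : n → R) :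
    M.det * D (adjForm M u v) - D M.det * adjForm M u v =
      M.det * (adjForm M (D ∘ u) v + adjForm M u (D ∘ v) - e * adjForm M u v)
      - adjForm M w₁ v * adjForm M u s₁ - adjForm M w₂ v * adjForm M u s₂ := by
  rw [det_mul_derivation_adjForm D M, h]
  have : v ⬝ᵥ ((M.adjugate * (vecMulVec w₁ s₁ + vecMulVec w₂ s₂ + e • M) * M.adjugate) *ᵥ u)
      = adjForm M w₁ v * adjForm M u s₁ + adjForm M w₂ v * adjForm M u s₂
        + e * M.det * adjForm M u v := by
    rw [Matrix.mul_add, Matrix.mul_add, Matrix.add_mul, Matrix.add_mul, add_mulVec, add_mulVec,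
      dotProduct_add, dotProduct_add, adjForm_conj_vecMulVec, adjForm_conj_vecMulVec,
      Matrix.mul_smul, adjugate_mul, Matrix.smul_mul, Matrix.smul_mul, Matrix.one_mul,
      smul_mulVec, smul_mulVec, dotProduct_smul, dotProduct_smul]
    simp only [smul_eq_mul, adjForm]; ring
  rw [this]; ring

/-- The matrix determinant lemma in adjugate form. -/
theorem det_add_vecMulVec_of_det_ne_zero [IsDomain R] (M : Matrix n n R) (hM : M.det ≠ 0)
    (u v : n → R) : (M + vecMulVec u v).det = M.det + adjForm M u v := by
  let φ := algebraMap R (FractionRing R)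
  have hφ : Function.Injective φ := IsFractionRing.injective R (FractionRing R)
  apply hφ
  have hdet : IsUnit (φ.mapMatrix M).det := by
    rw [← RingHom.map_det, isUnit_iff_ne_zero]
    exact (map_ne_zero_iff φ hφ).2 hM
  have e1 : φ.mapMatrix (M + vecMulVec u v) = φ.mapMatrix M +
      replicateCol Unit (φ ∘ u) * replicateRow Unit (φ ∘ v) := by
    ext i j; simp [vecMulVec_apply, Matrix.mul_apply]
  rw [RingHom.map_det, e1, det_add_replicateCol_mul_replicateRow hdet, map_add, RingHom.map_det,
    adjForm_eq_sum]
  have e2 : (φ.mapMatrix M)⁻¹ = ((φ.mapMatrix M).det)⁻¹ • φ.mapMatrix M.adjugate := by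
    rw [Matrix.inv_def, Ring.inverse_eq_inv', RingHom.map_adjugate]
  have e3 : (1 + replicateRow Unit (φ ∘ v) * (φ.mapMatrix M)⁻¹ *
      replicateCol Unit (φ ∘ u)).det = 1 + ((φ.mapMatrix M).det)⁻¹ *
        φ (∑ i, ∑ j, v i * (M.adjugate i j * u j)) := by
    rw [det_unique, e2, Matrix.mul_smul, Matrix.smul_mul, Matrix.add_apply, Matrix.smul_apply]
    rw [Finset.sum_comm]
    simp only [Matrix.mul_apply, map_sum, Finset.sum_mul]
    simp [mul_assoc]
  rw [e3, mul_add, mul_one, ← mul_assoc, mul_inv_cancel₀ hdet.ne_zero, one_mul]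

/-- The bilinear Toda equation for determinants with rank-one derivatives. -/
theorem bilinear_toda_of_rank_one (Dt Dd : Derivation k R R) (M : Matrix n n R)
    (I a b a' b' : R) (hI : I * I = -1) (ha : a * a' = 1) (hb : b * b' = 1)
    (ht : ∀ x ∈ ({I, a', b'} : Set R), Dt x = 0)
    (P Pm Q Qp : n → R)
    (hMt : M.map Dt = vecMulVec P Q + (I * (a - b)) • M)
    (hMd : M.map Dd = (a' * b') • vecMulVec Pm Qp + (I * (b' - a')) • M)
    (hPm : Dt ∘ Pm = (-(I * a)) • (P - Pm)) (hQp : Dt ∘ Qp = (I * b) • (Q - Qp)) :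
    Dt (Dd M.det) * M.det - Dt M.det * Dd M.det
      = M.det ^ 2 - (M.det + I * b' * adjForm M P Qp) * (M.det - I * a' * adjForm M Pm Q) := by
  simp only [Set.mem_insert_iff, Set.mem_singleton_iff, forall_eq_or_imp, forall_eq] at ht
  obtain ⟨hIt, hat', hbt'⟩ := ht
  replace hMt : M.map Dt = vecMulVec P Q + vecMulVec 0 0 + (I * (a - b)) • M := by simp [hMt]
  replace hMd : M.map Dd = vecMulVec ((a' * b') • Pm) Qp + vecMulVec 0 0 + (I * (b' - a')) • M := by
    simp [hMd, smul_vecMulVec]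
  have hX := derivation_adjForm_of_rank_two Dt M _ _ _ _ _ hMt Pm Qp
  rw [hPm, hQp] at hX
  rw [derivation_det_of_rank_two Dd M _ _ _ _ _ hMd]
  simp only [adjForm_zero_left, adjForm_smul_left, adjForm_smul_right, adjForm_sub_left,
    adjForm_sub_right, map_add, map_sub, Derivation.leibniz, hIt, hat', hbt',
    smul_eq_mul, mul_zero, add_zero, Derivation.map_natCast, zero_mul, sub_zero] at hX ⊢
  linear_combination (a' * b') * hX - (adjForm M P Qp * adjForm M Pm Q * a' * b') * hI
    - I * b' * M.det * adjForm M P Qp * ha + I * a' * M.det * adjForm M Pm Q * hb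

/-- The bilinear Schrödinger-type equation for determinants with rank-one `t`-derivative and
rank-two `z`-derivative. -/
theorem bilinear_schrodinger_of_rank_one [IsDomain R] (Dt Dz : Derivation k R R)
    (M : Matrix n n R)
    (hM : M.det ≠ 0) (I a b b' κ : R) (hI : I * I = -1) (hb : b * b' = 1)
    (ht : ∀ x ∈ ({I, a, b, b', κ} : Set R), Dt x = 0)
    (hz : ∀ x ∈ ({I, b', κ} : Set R), Dz x = 0)
    (P Pp Ppp Q Qm Qp : n → R)
    (hMt : M.map Dt = vecMulVec P Q + (I * (a - b)) • M)
    (hMz : M.map Dz = a • vecMulVec Pp Q + b • vecMulVec P Qm + (I * (a ^ 2 - b ^ 2)) • M)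
    (hP : Dt ∘ P = (-(I * a)) • (Pp - P)) (hPp : Dt ∘ Pp = (-(I * a)) • (Ppp - Pp))
    (hQ : Dt ∘ Q = (I * b) • (Qm - Q)) (hQp : Dt ∘ Qp = (I * b) • (Q - Qp))
    (hPz : Dz ∘ P = (-(I * a ^ 2)) • (Ppp - P)) (hQpz : Dz ∘ Qp = (I * b ^ 2) • (Qm - Qp))
    (τp : R) (hτp : τp = κ * (M.det + I * b' * adjForm M P Qp)) :
    -I * (Dz τp * M.det - τp * Dz M.det)
      = Dt (Dt τp) * M.det - 2 * Dt τp * Dt M.det + τp * Dt (Dt M.det) := by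
  simp only [Set.mem_insert_iff, Set.mem_singleton_iff, forall_eq_or_imp, forall_eq] at ht hz
  obtain ⟨hIt, hat, hbt, hbt', hκt⟩ := ht
  obtain ⟨hIz, hbz', hκz⟩ := hz
  replace hMt : M.map Dt = vecMulVec P Q + vecMulVec 0 0 + (I * (a - b)) • M := by simp [hMt]
  replace hMz : M.map Dz = vecMulVec (a • Pp) Q + vecMulVec (b • P) Qm
      + (I * (a ^ 2 - b ^ 2)) • M := by
    simp [hMz, smul_vecMulVec]
  have hTt := derivation_det_of_rank_two Dt M _ _ _ _ _ hMt
  have hTz := derivation_det_of_rank_two Dz M _ _ _ _ _ hMz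
  have hY := derivation_adjForm_of_rank_two Dt M _ _ _ _ _ hMt P Qp
  have hZ := derivation_adjForm_of_rank_two Dt M _ _ _ _ _ hMt P Q
  have hW := derivation_adjForm_of_rank_two Dt M _ _ _ _ _ hMt Pp Qp
  have hYz := derivation_adjForm_of_rank_two Dz M _ _ _ _ _ hMz P Qp
  rw [hP, hQp] at hY
  rw [hP, hQ] at hZ
  rw [hPp, hQp] at hW
  rw [hPz, hQpz] at hYz
  simp only [adjForm_zero_left, adjForm_smul_left, adjForm_smul_right, adjForm_sub_left,
    adjForm_sub_right, zero_mul, sub_zero, add_zero] at hTt hTz hY hZ hW hYz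
  have hTtt := congrArg Dt hTt
  have hYt := congrArg Dt hY
  simp only [map_add, map_sub, map_neg, Derivation.leibniz, hIt, hat, hbt, smul_eq_mul, mul_zero,
    add_zero, Derivation.map_natCast, sub_zero, neg_zero] at hTtt hYt
  subst hτp
  simp only [map_add, Derivation.leibniz, hIt, hbt', hκt, hIz, hbz', hκz, smul_eq_mul, mul_zero,
    add_zero]
  generalize Dt (Dt M.det) = Ttt at *
  generalize Dt M.det = Tt at *
  generalize Dz M.det = Tz at *
  generalize Dt (Dt (adjForm M P Qp)) = Ytt at *
  generalize Dt (adjForm M P Qp) = Yt at *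
  generalize Dz (adjForm M P Qp) = Yz at *
  generalize Dt (adjForm M P Q) = Zt at *
  generalize Dt (adjForm M Pp Qp) = Wt at *
  generalize adjForm M P Qp = Y at *
  generalize adjForm M P Q = Z at *
  generalize adjForm M Pp Qp = W at *
  generalize hT : M.det = T at *
  apply mul_left_cancel₀ hM
  subst hTt
  linear_combination (-I * I * b' * T * κ) * hYz - I * b' * T * κ * hYt
    + T * I ^ 2 * κ * b' * a * hW
    + κ * I * b' * (3 * Z + 2 * Fintype.card n * I * (a - b) * T) * hY
    - 2 * κ * T * (T + I * b' * Y) * hTtt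
    - κ * (I * b' * Y + I ^ 2 * b * b' * T + 2 * T) * hZ
    + 2 * T * κ * (Z ^ 2 + T * I * (a * adjForm M Pp Q - b * adjForm M P Qm))
      * (b * b' * hI - hb)

end bordered

end determinants

/-- The power series `exp (c X ^ j)`. -/
noncomputable def expMonomial (c : ℂ) (j : ℕ) : PowerSeries ℂ :=
  PowerSeries.mk fun m => if j ∣ m then c ^ (m / j) / (Nat.factorial (m / j) : ℂ) else 0

section schurRecursion
open PowerSeries

theorem derivative_expMonomial (c : ℂ) (j : ℕ) :
    d⁄dX ℂ (expMonomial c (j + 1)) =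
      PowerSeries.C ((j + 1 : ℂ) * c) * X ^ j * expMonomial c (j + 1) := by
  ext m
  rw [coeff_derivative, mul_assoc, coeff_C_mul, coeff_X_pow_mul']
  simp only [expMonomial, coeff_mk]
  by_cases h : j + 1 ∣ m + 1
  · obtain ⟨r, hr⟩ := h
    obtain _ | r := r
    · omega
    have hm : m = j + (j + 1) * r := by
      have : (j + 1) * (r + 1) = (j + 1) * r + j + 1 := by ring
      omega
    have h1 : (m + 1) / (j + 1) = r + 1 := by rw [hr]; exact Nat.mul_div_cancel_left _ (by omega)
    have h2 : m - j = (j + 1) * r := by omega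
    have h3 : (m - j) / (j + 1) = r := by rw [h2]; exact Nat.mul_div_cancel_left _ (by omega)
    rw [if_pos ⟨r + 1, hr⟩, if_pos (by omega), if_pos ⟨r, h2⟩, h1, h3, Nat.factorial_succ]
    have h4 : (m : ℂ) + 1 = (j + 1) * (r + 1) := by exact_mod_cast hr
    have h5 : (Nat.factorial r : ℂ) ≠ 0 := by exact_mod_cast Nat.factorial_ne_zero r
    have h6 : (r : ℂ) + 1 ≠ 0 := by exact_mod_cast Nat.succ_ne_zero r
    rw [h4]
    push_cast
    field_simp
    ring
  · rw [if_neg h, zero_mul]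
    split_ifs with h1 h2
    · exact absurd (by obtain ⟨r, hr⟩ := h2; exact ⟨r + 1, by rw [mul_add]; omega⟩) h
    · simp
    · simp

/-- The truncated generating function of the Schur polynomials. -/
noncomputable def schurProd (x : ℕ → ℂ) (K : ℕ) : PowerSeries ℂ :=
  ∏ j ∈ Finset.range K, expMonomial (x (j + 1)) (j + 1)

theorem derivative_schurProd (x : ℕ → ℂ) (K : ℕ) :
    d⁄dX ℂ (schurProd x K) = (∑ j ∈ Finset.range K, PowerSeries.C ((j + 1 : ℂ) * x (j + 1)) * X ^ j)
      * schurProd x K := by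
  induction K with
  | zero => simp [schurProd]
  | succ K ih =>
    have h : schurProd x (K + 1) = schurProd x K * expMonomial (x (K + 1)) (K + 1) :=
      Finset.prod_range_succ _ _
    rw [h, Derivation.leibniz, ih, derivative_expMonomial, Finset.sum_range_succ]
    simp only [smul_eq_mul]
    ring

theorem coeff_eq_of_X_pow_dvd_sub {f g : PowerSeries ℂ} {m k : ℕ} (hm : m ≤ k)
    (h : X ^ (k + 1) ∣ f - g) : coeff m f = coeff m g := by
  have := (X_pow_dvd_iff.1 h) m (by omega)
  rwa [map_sub, sub_eq_zero] at this

theorem X_pow_dvd_prod_sub_prod {ι : Type*} (s : Finset ι) (f g : ι → PowerSeries ℂ) (k : ℕ)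
    (h : ∀ i ∈ s, X ^ k ∣ f i - g i) : X ^ k ∣ ∏ i ∈ s, f i - ∏ i ∈ s, g i := by
  rw [← Ideal.mem_span_singleton, ← Ideal.Quotient.mk_eq_mk_iff_sub_mem, map_prod, map_prod]
  refine Finset.prod_congr rfl fun i hi => ?_
  rw [Ideal.Quotient.mk_eq_mk_iff_sub_mem, Ideal.mem_span_singleton]
  exact h i hi

theorem coeff_schurProd_of_le (x : ℕ → ℂ) {m K : ℕ} (h : m ≤ K) :
    coeff m (schurProd x K) = coeff m (schurProd x m) := by
  have h1 : schurProd x m = ∏ j ∈ Finset.range K,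
      if j < m then expMonomial (x (j + 1)) (j + 1) else 1 := by
    rw [schurProd, ← Finset.prod_subset (Finset.range_mono h)]
    · exact Finset.prod_congr rfl fun j hj => by rw [if_pos (Finset.mem_range.1 hj)]
    · intro j _ hj
      rw [if_neg (by simpa using hj)]
  rw [h1, schurProd]
  refine coeff_eq_of_X_pow_dvd_sub le_rfl (X_pow_dvd_prod_sub_prod _ _ _ _ fun j _ => ?_)
  split_ifs with hj
  · simp
  · rw [X_pow_dvd_iff]
    intro r hr
    rw [map_sub, expMonomial, coeff_mk, coeff_one]
    by_cases hr0 : r = 0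
    · simp [hr0]
    · rw [if_neg (fun hd => by have := Nat.le_of_dvd (by omega) hd; omega), if_neg hr0, sub_zero]

theorem coeff_schurProd_self (x : ℕ → ℂ) (k : ℕ) : coeff k (schurProd x k) = schur k x := by
  have h1 : coeff k (schurProd x k) = coeff k (∏ j : Fin k, ∑ l : Fin (k + 1),
      PowerSeries.monomial (((j : ℕ) + 1) * l) (x (j + 1) ^ (l : ℕ) / (Nat.factorial l : ℂ))) := by
    rw [schurProd, ← Fin.prod_univ_eq_prod_range (fun j => expMonomial (x (j + 1)) (j + 1)) k]
    refine coeff_eq_of_X_pow_dvd_sub le_rfl (X_pow_dvd_prod_sub_prod _ _ _ _ fun j _ => ?_)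
    rw [X_pow_dvd_iff]
    intro r hr
    rw [map_sub, sub_eq_zero, map_sum, expMonomial, coeff_mk]
    simp only [coeff_monomial]
    split_ifs with hd
    · obtain ⟨d, rfl⟩ := hd
      have hdk : d < k + 1 := lt_of_le_of_lt (Nat.le_mul_of_pos_left d (Nat.succ_pos _)) hr
      rw [Finset.sum_eq_single ⟨d, hdk⟩]
      · rw [if_pos rfl, Nat.mul_div_cancel_left _ (Nat.succ_pos _)]
      · intro b _ hb
        rw [if_neg]
        intro he
        exact hb (Fin.ext (Nat.eq_of_mul_eq_mul_left (Nat.succ_pos _) he).symm)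
      · simp
    · rw [Finset.sum_eq_zero]
      intro b _
      rw [if_neg]
      rintro rfl
      exact hd ⟨_, rfl⟩
  rw [h1, Fintype.prod_sum, map_sum, schur, Finset.sum_filter]
  refine Finset.sum_congr rfl fun l _ => ?_
  rw [prod_monomial, coeff_monomial]
  simp only [eq_comm]

theorem schur_succ (x : ℕ → ℂ) (k : ℕ) :
    ((k : ℂ) + 1) * schur (k + 1) x =
      ∑ j ∈ Finset.range (k + 1), ((j + 1 : ℂ) * x (j + 1)) * schur (k - j) x := by
  rw [← coeff_schurProd_self, mul_comm, ← coeff_derivative, derivative_schurProd, Finset.sum_mul,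
    map_sum]
  refine Finset.sum_congr rfl fun j hj => ?_
  rw [mul_assoc, coeff_C_mul, coeff_X_pow_mul', if_pos (by simpa [Nat.lt_succ_iff] using hj),
    coeff_schurProd_of_le x (by omega), coeff_schurProd_self]

theorem schur_zero (x : ℕ → ℂ) : schur 0 x = 1 := by
  rw [← coeff_schurProd_self]
  simp [schurProd]

end schurRecursion

section schurRec
open PowerSeries

theorem eq_zero_of_derivative_eq_mul {R : Type*} [CommRing R] [IsDomain R] [CharZero R]
    (A G : PowerSeries R) (h : d⁄dX R G = A * G) (h0 : constantCoeff G = 0) : G = 0 := by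
  ext k
  rw [map_zero]
  induction k using Nat.strong_induction_on with
  | _ k ih =>
    obtain _ | k := k
    · simpa using h0
    · have h1 := congrArg (coeff k) h
      rw [coeff_derivative, coeff_mul, Finset.sum_eq_zero] at h1
      · exact (mul_eq_zero.1 h1).resolve_right (by exact_mod_cast Nat.succ_ne_zero k)
      · intro r hr
        rw [ih _ (by have := Finset.HasAntidiagonal.mem_antidiagonal.1 hr; omega), mul_zero]

variable {R : Type*} [CommRing R] [Algebra ℂ R]

/-- The Schur polynomials evaluated at a sequence in a `ℂ`-algebra, defined by the recursion
`(k + 1) S_{k+1} = ∑_{j ≤ k} (j + 1) x_{j+1} S_{k-j}`. -/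
noncomputable def schurRec (x : ℕ → R) : ℕ → R
  | 0 => 1
  | k + 1 => algebraMap ℂ R ((k + 1 : ℂ)⁻¹) *
      ∑ j : Fin (k + 1), ((j : R) + 1) * x (j + 1) * schurRec x (k - j)

theorem succ_mul_schurRec_succ (x : ℕ → R) (k : ℕ) :
    ((k : R) + 1) * schurRec x (k + 1) =
      ∑ j ∈ Finset.range (k + 1), ((j : R) + 1) * x (j + 1) * schurRec x (k - j) := by
  have h : ((k : R) + 1) * algebraMap ℂ R ((k + 1 : ℂ)⁻¹) = 1 := by
    have h0 : (k : ℂ) + 1 ≠ 0 := by exact_mod_cast Nat.succ_ne_zero k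
    have h1 : (k : R) + 1 = algebraMap ℂ R (k + 1 : ℂ) := by simp
    rw [h1, ← map_mul, mul_inv_cancel₀ h0, map_one]
  rw [schurRec, ← mul_assoc, h, one_mul,
    ← Fin.sum_univ_eq_sum_range (fun j => ((j : R) + 1) * x (j + 1) * schurRec x (k - j))]

theorem map_schurRec {S : Type*} [CommRing S] [Algebra ℂ S] (φ : R →ₐ[ℂ] S) (x : ℕ → R) (k : ℕ) :
    φ (schurRec x k) = schurRec (φ ∘ x) k := by
  induction k using Nat.strong_induction_on with
  | _ k ih =>
    obtain _ | k := k
    · simp [schurRec]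
    · rw [schurRec, schurRec, map_mul, AlgHom.commutes, map_sum]
      congr 1
      refine Finset.sum_congr rfl fun j _ => ?_
      rw [map_mul, map_mul, ih _ (by omega)]
      simp

/-- The generating series of `schurRec x`. -/
noncomputable def schurSeries (x : ℕ → R) : PowerSeries R := PowerSeries.mk (schurRec x)

theorem derivative_schurSeries (x : ℕ → R) :
    d⁄dX R (schurSeries x) = d⁄dX R (PowerSeries.mk x) * schurSeries x := by
  ext k
  rw [coeff_derivative, schurSeries, coeff_mk, mul_comm, succ_mul_schurRec_succ, coeff_mul,
    Finset.Nat.sum_antidiagonal_eq_sum_range_succ_mk]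
  refine Finset.sum_congr rfl fun j _ => ?_
  simp only [coeff_derivative, coeff_mk]
  ring

theorem constantCoeff_schurSeries (x : ℕ → R) : constantCoeff (schurSeries x) = 1 := by
  rw [← coeff_zero_eq_constantCoeff_apply, schurSeries, coeff_mk, schurRec]

/-- Coefficientwise application of a derivation to a power series. -/
noncomputable def derivCoeff (D : Derivation ℂ R R) (F : PowerSeries R) : PowerSeries R :=
  PowerSeries.mk fun k => D (coeff k F)

theorem derivCoeff_mul (D : Derivation ℂ R R) (F G : PowerSeries R) :
    derivCoeff D (F * G) = derivCoeff D F * G + F * derivCoeff D G := by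
  ext k
  simp only [derivCoeff, coeff_mk, coeff_mul, map_add, map_sum, D.leibniz, smul_eq_mul,
    ← Finset.sum_add_distrib]
  exact Finset.sum_congr rfl fun r _ => by ring

theorem derivative_derivCoeff (D : Derivation ℂ R R) (F : PowerSeries R) :
    d⁄dX R (derivCoeff D F) = derivCoeff D (d⁄dX R F) := by
  ext k
  have h : D ((k : R) + 1) = 0 := by simp
  simp only [derivCoeff, coeff_derivative, coeff_mk, D.leibniz, h, smul_eq_mul]
  ring

theorem derivCoeff_schurSeries [IsDomain R] [CharZero R] (D : Derivation ℂ R R) (x : ℕ → R)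
    (hx : D (x 0) = 0) :
    derivCoeff D (schurSeries x) = derivCoeff D (PowerSeries.mk x) * schurSeries x := by
  rw [← sub_eq_zero]
  refine eq_zero_of_derivative_eq_mul (d⁄dX R (PowerSeries.mk x)) _ ?_ ?_
  · rw [map_sub, Derivation.leibniz, derivative_derivCoeff, derivative_derivCoeff,
      derivative_schurSeries, derivCoeff_mul]
    simp only [smul_eq_mul]
    ring
  · rw [map_sub, map_mul, ← coeff_zero_eq_constantCoeff_apply, ← coeff_zero_eq_constantCoeff_apply]
    simp [derivCoeff, hx, schurSeries, schurRec]

/-- The power series `exp (s X)`. -/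
noncomputable def expSeries (R : Type*) [CommRing R] [Algebra ℂ R] (s : ℂ) : PowerSeries R :=
  PowerSeries.mk fun m => algebraMap ℂ R (s ^ m / (Nat.factorial m : ℂ))

theorem derivative_expSeries (s : ℂ) :
    d⁄dX R (expSeries R s) = PowerSeries.C (algebraMap ℂ R s) * expSeries R s := by
  ext k
  have h : (k : R) + 1 = algebraMap ℂ R (k + 1 : ℂ) := by simp
  rw [coeff_derivative, coeff_C_mul, expSeries, coeff_mk, coeff_mk, h, ← map_mul, ← map_mul]
  congr 1
  have h5 : (Nat.factorial k : ℂ) ≠ 0 := by exact_mod_cast Nat.factorial_ne_zero k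
  have h6 : (k : ℂ) + 1 ≠ 0 := by exact_mod_cast Nat.succ_ne_zero k
  rw [Nat.factorial_succ]
  push_cast
  field_simp
  ring

theorem schurSeries_add_smul_X [IsDomain R] [CharZero R] (x x' : ℕ → R) (s : ℂ)
    (h : PowerSeries.mk x' = PowerSeries.mk x + PowerSeries.C (algebraMap ℂ R s) * X) :
    schurSeries x' = expSeries R s * schurSeries x := by
  rw [← sub_eq_zero]
  refine eq_zero_of_derivative_eq_mul (d⁄dX R (PowerSeries.mk x')) _ ?_ ?_
  · rw [map_sub, Derivation.leibniz, derivative_schurSeries, derivative_schurSeries,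
      derivative_expSeries, h, map_add, Derivation.leibniz, derivative_C, derivative_X]
    simp only [smul_eq_mul]
    ring
  · rw [map_sub, map_mul, constantCoeff_schurSeries, constantCoeff_schurSeries,
      ← coeff_zero_eq_constantCoeff_apply]
    simp [expSeries]

end schurRec

section lumpPolynomials
open MvPolynomial

/-- Translation `n ↦ n + s i` of the first variable. -/
noncomputable def shiftN (s : ℂ) : MvPolynomial (Fin 4) ℂ →ₐ[ℂ] MvPolynomial (Fin 4) ℂ :=
  aeval fun j => if j = 0 then X 0 + C (s * Complex.I) else X j

theorem shiftN_comp (s r : ℂ) (f : MvPolynomial (Fin 4) ℂ) :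
    shiftN s (shiftN r f) = shiftN (s + r) f := by
  have : (shiftN s).comp (shiftN r) = shiftN (s + r) := by
    apply MvPolynomial.algHom_ext
    intro j
    by_cases hj : j = 0
    · simp [shiftN, hj]
      ring
    · simp [shiftN, hj]
  exact DFunLike.congr_fun this f

theorem shiftN_zero (f : MvPolynomial (Fin 4) ℂ) : shiftN 0 f = f := by
  have : shiftN 0 = AlgHom.id ℂ _ := by
    apply MvPolynomial.algHom_ext
    intro j
    by_cases hj : j = 0 <;> simp [shiftN, hj]
  exact DFunLike.congr_fun this f

theorem pderiv_shiftN (s : ℂ) (j : Fin 4) (hj : j ≠ 0) (f : MvPolynomial (Fin 4) ℂ) :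
    pderiv j (shiftN s f) = shiftN s (pderiv j f) := by
  induction f using MvPolynomial.induction_on with
  | C a => simp [shiftN]
  | add f g hf hg => simp only [map_add, hf, hg]
  | mul_X f i hf =>
    rw [map_mul, pderiv_mul, pderiv_mul, map_add, map_mul, map_mul, hf]
    congr 2
    by_cases hi : i = 0
    · subst hi
      simp [shiftN, pderiv_X_of_ne hj.symm]
    · by_cases hij : i = j
      · subst hij; simp [shiftN, hi]
      · simp [shiftN, hi, pderiv_X_of_ne hij]

theorem pderiv_comm (i j : Fin 4) (f : MvPolynomial (Fin 4) ℂ) :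
    pderiv i (pderiv j f) = pderiv j (pderiv i f) := by
  have : ⁅(pderiv i : Derivation ℂ (MvPolynomial (Fin 4) ℂ) (MvPolynomial (Fin 4) ℂ)),
      (pderiv j : Derivation ℂ (MvPolynomial (Fin 4) ℂ) (MvPolynomial (Fin 4) ℂ))⁆ = 0 := by
    apply MvPolynomial.derivation_ext
    intro l
    rw [Derivation.commutator_apply]
    rw [pderiv_X, pderiv_X, Pi.single_apply, Pi.single_apply]
    split_ifs <;> simp
  have h := DFunLike.congr_fun this f
  rwa [Derivation.commutator_apply, Derivation.coe_zero, Pi.zero_apply, sub_eq_zero] at h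

theorem iterate_derivation_mul_eq_zero {R : Type*} [CommRing R] [Algebra ℂ R]
    (D : Derivation ℂ R R) (m : ℕ) : ∀ (u v : ℕ) (f g : R), u + v = m + 1 →
      D^[u] f = 0 → D^[v] g = 0 → D^[m] (f * g) = 0 := by
  induction m with
  | zero =>
    intro u v f g h hf hg
    rcases Nat.eq_zero_or_pos u with rfl | hu
    · simp_all
    · obtain rfl : v = 0 := by omega
      simp_all
  | succ m ih =>
    intro u v f g h hf hg
    obtain _ | u := u
    · simp_all [iterate_map_zero]
    obtain _ | v := v
    · simp_all [iterate_map_zero]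
    rw [Function.iterate_succ_apply, D.leibniz, iterate_map_add, smul_eq_mul, smul_eq_mul,
      ih (u + 1) v f (D g) (by omega) hf hg, ih (v + 1) u g (D f) (by omega) hg hf, add_zero]

/-- The truncated Neumann series `∑_{σ ≤ K} (-1)^σ c^{-σ-1} D^σ` inverting `D + c`. -/
noncomputable def neumann (c : ℂ) (K : ℕ) (f : MvPolynomial (Fin 4) ℂ) : MvPolynomial (Fin 4) ℂ :=
  ∑ σ ∈ Finset.range (K + 1), C ((-1) ^ σ / c ^ (σ + 1)) * (pderiv 1)^[σ] f

theorem neumann_add (c : ℂ) (K : ℕ) (f g : MvPolynomial (Fin 4) ℂ) :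
    neumann c K (f + g) = neumann c K f + neumann c K g := by
  simp only [neumann, iterate_map_add, mul_add, Finset.sum_add_distrib]

theorem iterate_pderiv_C_mul (r : ℂ) (j : Fin 4) (f : MvPolynomial (Fin 4) ℂ) (m : ℕ) :
    (pderiv j)^[m] (C r * f) = C r * (pderiv j)^[m] f := by
  induction m with
  | zero => rfl
  | succ m ih => rw [Function.iterate_succ_apply', Function.iterate_succ_apply', ih, pderiv_C_mul]

theorem neumann_C_mul (c : ℂ) (K : ℕ) (r : ℂ) (f : MvPolynomial (Fin 4) ℂ) :
    neumann c K (C r * f) = C r * neumann c K f := by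
  simp only [neumann, iterate_pderiv_C_mul, Finset.mul_sum]
  exact Finset.sum_congr rfl fun _ _ => by ring

theorem iterate_pderiv_comm (i j : Fin 4) (m : ℕ) (f : MvPolynomial (Fin 4) ℂ) :
    pderiv i ((pderiv j)^[m] f) = (pderiv j)^[m] (pderiv i f) :=
  (Function.Commute.iterate_right (f := pderiv i) (g := pderiv j)
    (fun g => pderiv_comm i j g) m) f

theorem iterate_pderiv_shiftN (s : ℂ) (m : ℕ) (f : MvPolynomial (Fin 4) ℂ) :
    shiftN s ((pderiv 1)^[m] f) = (pderiv 1)^[m] (shiftN s f) :=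
  (Function.Commute.iterate_right (f := shiftN s) (g := pderiv 1)
    (fun g => (pderiv_shiftN s 1 (by decide) g).symm) m) f

theorem pderiv_neumann (c : ℂ) (K : ℕ) (j : Fin 4) (f : MvPolynomial (Fin 4) ℂ) :
    pderiv j (neumann c K f) = neumann c K (pderiv j f) := by
  simp only [neumann, map_sum, pderiv_C_mul, iterate_pderiv_comm]

theorem shiftN_neumann (c : ℂ) (K : ℕ) (s : ℂ) (f : MvPolynomial (Fin 4) ℂ) :
    shiftN s (neumann c K f) = neumann c K (shiftN s f) := by
  simp only [neumann, map_sum, map_mul, iterate_pderiv_shiftN]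
  simp [shiftN]

theorem neumann_pderiv_add (c : ℂ) (hc : c ≠ 0) (K : ℕ) (f : MvPolynomial (Fin 4) ℂ)
    (hf : (pderiv 1)^[K + 1] f = 0) : neumann c K (pderiv 1 f + C c * f) = f := by
  have h : ∀ L, neumann c L (pderiv 1 f + C c * f)
      = f + C ((-1) ^ L / c ^ (L + 1)) * (pderiv 1)^[L + 1] f := by
    intro L
    induction L with
    | zero =>
      have h1 : C (1 / c) * C c = (1 : MvPolynomial (Fin 4) ℂ) := by
        rw [← C_mul, one_div_mul_cancel hc, C_1]
      simp only [neumann, zero_add, Finset.sum_range_one, pow_zero, pow_one, Function.iterate_zero,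
        id, Function.iterate_one]
      linear_combination f * h1
    | succ L ih =>
      have h1 : C ((-1) ^ (L + 1) / c ^ (L + 1 + 1)) * C c
          = -(C ((-1) ^ L / c ^ (L + 1)) : MvPolynomial (Fin 4) ℂ) := by
        rw [← C_mul, ← C_neg]
        congr 1
        field_simp
        ring
      have h2 : neumann c (L + 1) (pderiv 1 f + C c * f) = neumann c L (pderiv 1 f + C c * f)
          + C ((-1) ^ (L + 1) / c ^ (L + 1 + 1)) * (pderiv 1)^[L + 1] (pderiv 1 f + C c * f) :=
        Finset.sum_range_succ _ _
      rw [h2, ih, iterate_map_add, iterate_pderiv_C_mul, ← Function.iterate_succ_apply]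
      linear_combination (pderiv 1)^[L + 1] f * h1
  rw [h K, hf, mul_zero, add_zero]

/-- The linear forms whose Schur polynomials are `P_k` (for `ε = 1`, `a = e^p`) and `Q_k`
(for `ε = -1`, `a = e^q`). -/
noncomputable def lumpForm (ε a : ℂ) (m : ℕ) : MvPolynomial (Fin 4) ℂ :=
  if m = 0 then 0 else
    C (-(ε * Complex.I) * (if m = 1 then 1 else 0)) * X 0
    + C (-(ε * Complex.I * a) * (1 / (Nat.factorial m : ℂ))) * X 1
    + C (-(ε * Complex.I) * ((a⁻¹ * (-1) ^ m + a ^ 2 * 2 ^ m) / (Nat.factorial m : ℂ))) * X 2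
    + C (-(ε * Complex.I * a ^ 2) * (2 ^ m / (Nat.factorial m : ℂ))) * X 3

/-- The Schur polynomials of `lumpForm`. -/
noncomputable def lumpSchur (ε a : ℂ) (k : ℕ) : MvPolynomial (Fin 4) ℂ :=
  schurRec (lumpForm ε a) k

theorem shiftN_lumpSchur (ε a s : ℂ) (k : ℕ) :
    shiftN s (lumpSchur ε a k) = PowerSeries.coeff k
      (expSeries _ (ε * s) * schurSeries (lumpForm ε a)) := by
  rw [← schurSeries_add_smul_X (lumpForm ε a) (shiftN s ∘ lumpForm ε a), schurSeries,
    PowerSeries.coeff_mk, lumpSchur, map_schurRec]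
  ext1 m
  rw [map_add, PowerSeries.coeff_C_mul, PowerSeries.coeff_mk, PowerSeries.coeff_mk,
    PowerSeries.coeff_X, Function.comp_apply]
  by_cases hm : m = 0
  · simp [lumpForm, hm]
  by_cases hm1 : m = 1
  · simp only [lumpForm, hm1, shiftN, map_mul, algebraMap_eq]
    have h : (C Complex.I : MvPolynomial (Fin 4) ℂ) * C Complex.I = -1 := by
      rw [← C_mul, Complex.I_mul_I, C_neg, C_1]
    simp
    linear_combination (-(C ε) * C s) * h
  · simp [lumpForm, hm, hm1, shiftN]

theorem pderiv_lumpSchur (ε a : ℂ) (j : Fin 4) (k : ℕ) :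
    pderiv j (lumpSchur ε a k) = PowerSeries.coeff k
      (derivCoeff (pderiv j) (PowerSeries.mk (lumpForm ε a)) * schurSeries (lumpForm ε a)) := by
  rw [← derivCoeff_schurSeries _ _ (by simp [lumpForm]), derivCoeff, PowerSeries.coeff_mk,
    schurSeries, PowerSeries.coeff_mk, lumpSchur]

theorem pderiv_one_lumpForm (ε a : ℂ) :
    derivCoeff (pderiv 1) (PowerSeries.mk (lumpForm ε a))
      = PowerSeries.C (C (-(ε * Complex.I * a))) * (expSeries _ 1 - 1) := by
  ext1 m
  rw [derivCoeff, PowerSeries.coeff_mk, PowerSeries.coeff_mk, PowerSeries.coeff_C_mul, map_sub,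
    expSeries, PowerSeries.coeff_mk, PowerSeries.coeff_one]
  by_cases hm : m = 0
  · simp [lumpForm, hm]
  · simp only [lumpForm, hm, if_false, map_add, pderiv_C_mul, one_pow, algebraMap_eq, sub_zero,
      ← C_mul]
    simp [pderiv_X]

theorem pderiv_three_lumpForm (ε a : ℂ) :
    derivCoeff (pderiv 3) (PowerSeries.mk (lumpForm ε a))
      = PowerSeries.C (C (-(ε * Complex.I * a ^ 2))) * (expSeries _ 2 - 1) := by
  ext1 m
  rw [derivCoeff, PowerSeries.coeff_mk, PowerSeries.coeff_mk, PowerSeries.coeff_C_mul, map_sub,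
    expSeries, PowerSeries.coeff_mk, PowerSeries.coeff_one]
  by_cases hm : m = 0
  · simp [lumpForm, hm]
  · simp only [lumpForm, hm, if_false, map_add, pderiv_C_mul, algebraMap_eq, sub_zero, ← C_mul]
    simp [pderiv_X]

theorem pderiv_three_sub_two_lumpForm (ε a : ℂ) :
    derivCoeff (pderiv 3 - pderiv 2) (PowerSeries.mk (lumpForm ε a))
      = PowerSeries.C (C (ε * Complex.I * a⁻¹)) * (expSeries _ (-1) - 1) := by
  ext1 m
  rw [derivCoeff, PowerSeries.coeff_mk, PowerSeries.coeff_mk, PowerSeries.coeff_C_mul, map_sub,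
    expSeries, PowerSeries.coeff_mk, PowerSeries.coeff_one]
  by_cases hm : m = 0
  · simp [lumpForm, hm]
  · simp only [lumpForm, hm, if_false, map_add, Derivation.sub_apply, pderiv_C_mul,
      algebraMap_eq, sub_zero, ← C_mul]
    simp only [pderiv_X, Pi.single_apply]
    simp only [Fin.reduceEq, if_false, if_true, mul_zero, mul_one, zero_add, zero_sub,
      sub_zero, ← C_neg]
    rw [← C_add]
    congr 1
    ring

theorem pderiv_one_lumpSchur (ε a : ℂ) (hε : ε * ε = 1) (k : ℕ) :
    pderiv 1 (lumpSchur ε a k)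
      = C (-(ε * Complex.I * a)) * (shiftN ε (lumpSchur ε a k) - lumpSchur ε a k) := by
  rw [pderiv_lumpSchur, pderiv_one_lumpForm, shiftN_lumpSchur, hε, mul_assoc,
    PowerSeries.coeff_C_mul, sub_mul, one_mul, map_sub]
  simp [schurSeries, lumpSchur]

theorem pderiv_three_lumpSchur (ε a : ℂ) (hε : ε * ε = 1) (k : ℕ) :
    pderiv 3 (lumpSchur ε a k)
      = C (-(ε * Complex.I * a ^ 2)) * (shiftN (2 * ε) (lumpSchur ε a k) - lumpSchur ε a k) := by
  rw [pderiv_lumpSchur, pderiv_three_lumpForm, shiftN_lumpSchur,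
    show ε * (2 * ε) = 2 by linear_combination 2 * hε, mul_assoc,
    PowerSeries.coeff_C_mul, sub_mul, one_mul, map_sub]
  simp [schurSeries, lumpSchur]

theorem pderiv_three_sub_two_lumpSchur (ε a : ℂ) (hε : ε * ε = 1) (k : ℕ) :
    (pderiv 3 - pderiv 2 : Derivation ℂ (MvPolynomial (Fin 4) ℂ) (MvPolynomial (Fin 4) ℂ))
        (lumpSchur ε a k)
      = C (ε * Complex.I * a⁻¹) * (shiftN (-ε) (lumpSchur ε a k) - lumpSchur ε a k) := by
  have h := congrArg (PowerSeries.coeff k)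
    (derivCoeff_schurSeries (pderiv 3 - pderiv 2) (lumpForm ε a) (by simp [lumpForm]))
  rw [derivCoeff, PowerSeries.coeff_mk, schurSeries, PowerSeries.coeff_mk] at h
  rw [lumpSchur, h, ← lumpSchur, ← schurSeries, pderiv_three_sub_two_lumpForm, shiftN_lumpSchur,
    show ε * (-ε) = -1 by linear_combination -hε, mul_assoc,
    PowerSeries.coeff_C_mul, sub_mul, one_mul, map_sub]
  simp [schurSeries, lumpSchur]

theorem iterate_pderiv_one_lumpSchur (ε a : ℂ) (k : ℕ) : ∀ m, k < m →
    (pderiv 1)^[m] (lumpSchur ε a k) = 0 := by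
  induction k using Nat.strong_induction_on with
  | _ k ih =>
    intro m hm
    obtain _ | m := m
    · omega
    rw [Function.iterate_succ_apply, pderiv_lumpSchur, pderiv_one_lumpForm, PowerSeries.coeff_mul]
    have h : ∀ (s : Finset (ℕ × ℕ)) (f : ℕ × ℕ → MvPolynomial (Fin 4) ℂ),
        (pderiv 1)^[m] (∑ r ∈ s, f r) = ∑ r ∈ s, (pderiv 1)^[m] (f r) := by
      intro s f
      induction s using Finset.cons_induction with
      | empty => simp [iterate_map_zero]
      | cons r s hr ih => rw [Finset.sum_cons, Finset.sum_cons, iterate_map_add, ih]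
    rw [h]
    refine Finset.sum_eq_zero fun r hr => ?_
    have hr' := Finset.HasAntidiagonal.mem_antidiagonal.1 hr
    rw [PowerSeries.coeff_C_mul, mul_assoc, iterate_pderiv_C_mul, map_sub, expSeries,
      PowerSeries.coeff_mk, PowerSeries.coeff_one]
    by_cases h0 : r.1 = 0
    · simp [h0, iterate_map_zero]
    · rw [if_neg h0, sub_zero, algebraMap_eq, iterate_pderiv_C_mul, schurSeries,
        PowerSeries.coeff_mk, ← lumpSchur, ih _ (by omega) _ (by omega), mul_zero, mul_zero]

end lumpPolynomials

section lumpMatrix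
open MvPolynomial Matrix

theorem pderiv_one_shiftN_lumpSchur_one (a s : ℂ) (k : ℕ) :
    pderiv 1 (shiftN s (lumpSchur 1 a k))
      = -(C Complex.I * C a) * (shiftN (s + 1) (lumpSchur 1 a k) - shiftN s (lumpSchur 1 a k)) := by
  rw [pderiv_shiftN _ _ (by decide), pderiv_one_lumpSchur _ _ (by norm_num), map_mul, map_sub,
    shiftN_comp]
  simp [shiftN]

theorem pderiv_one_shiftN_lumpSchur_neg_one (b s : ℂ) (k : ℕ) :
    pderiv 1 (shiftN s (lumpSchur (-1) b k)) = C Complex.I * C b *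
      (shiftN (s - 1) (lumpSchur (-1) b k) - shiftN s (lumpSchur (-1) b k)) := by
  rw [pderiv_shiftN _ _ (by decide), pderiv_one_lumpSchur _ _ (by norm_num), map_mul, map_sub,
    shiftN_comp, ← sub_eq_add_neg]
  simp [shiftN]

/-- The polynomial `∑_σ (-1)^σ c^{-σ-1} ∂_t^σ (P_k^{(s)} Q_l^{(r)})`, `c = -i a + i b`, where
the superscripts denote translations of `n`. -/
noncomputable def lumpEntry (a b : ℂ) (k l : ℕ) (s r : ℂ) : MvPolynomial (Fin 4) ℂ :=
  neumann (-Complex.I * a + Complex.I * b) (k + l)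
    (shiftN s (lumpSchur 1 a k) * shiftN r (lumpSchur (-1) b l))

theorem iterate_pderiv_one_lumpSchur_mul (a b : ℂ) (k l : ℕ) (s r : ℂ) :
    (pderiv 1)^[k + l + 1]
      (shiftN s (lumpSchur 1 a k) * shiftN r (lumpSchur (-1) b l)) = 0 := by
  have hP : (pderiv 1)^[k + 1] (shiftN s (lumpSchur 1 a k)) = 0 := by
    rw [← iterate_pderiv_shiftN, iterate_pderiv_one_lumpSchur _ _ _ _ (Nat.lt_succ_self _),
      map_zero]
  have hQ : (pderiv 1)^[l + 1] (shiftN r (lumpSchur (-1) b l)) = 0 := by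
    rw [← iterate_pderiv_shiftN, iterate_pderiv_one_lumpSchur _ _ _ _ (Nat.lt_succ_self _),
      map_zero]
  exact iterate_derivation_mul_eq_zero (pderiv 1) (k + l + 1) (k + 1) (l + 1) _ _ (by omega) hP hQ

theorem lumpEntry_relation (a b : ℂ) (hab : a ≠ b) (k l : ℕ) (s r : ℂ) :
    -(C Complex.I * C a) * lumpEntry a b k l (s + 1) r
        + C Complex.I * C b * lumpEntry a b k l s (r - 1)
      = shiftN s (lumpSchur 1 a k) * shiftN r (lumpSchur (-1) b l) := by
  have hc : -Complex.I * a + Complex.I * b ≠ 0 := by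
    rw [show -Complex.I * a + Complex.I * b = Complex.I * (b - a) by ring]
    exact mul_ne_zero Complex.I_ne_zero (sub_ne_zero.2 hab.symm)
  have h0 := iterate_pderiv_one_lumpSchur_mul a b k l s r
  refine Eq.trans ?_ (neumann_pderiv_add _ hc _ _ h0)
  rw [lumpEntry, lumpEntry, ← C_mul, ← C_mul, ← C_neg, ← neumann_C_mul, ← neumann_C_mul,
    ← neumann_add]
  refine congrArg (neumann _ _) ?_
  rw [pderiv_mul, pderiv_one_shiftN_lumpSchur_one, pderiv_one_shiftN_lumpSchur_neg_one]
  simp only [C_mul, C_neg, C_add]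
  ring

theorem C_I_mul_C_I : (C Complex.I : MvPolynomial (Fin 4) ℂ) * C Complex.I = -1 := by
  rw [← C_mul, Complex.I_mul_I, C_neg, C_1]

theorem pderiv_one_lumpEntry (a b : ℂ) (hab : a ≠ b) (k l : ℕ) :
    pderiv 1 (lumpEntry a b k l 0 0) = lumpSchur 1 a k * lumpSchur (-1) b l
      + C Complex.I * (C a - C b) * lumpEntry a b k l 0 0 := by
  have h := lumpEntry_relation a b hab k l 0 0
  rw [shiftN_zero, shiftN_zero] at h
  rw [← h, lumpEntry, pderiv_neumann, pderiv_mul, pderiv_one_shiftN_lumpSchur_one,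
    pderiv_one_shiftN_lumpSchur_neg_one, lumpEntry, lumpEntry, ← C_mul, ← C_mul, ← C_neg, ← C_sub,
    ← C_mul, ← neumann_C_mul, ← neumann_C_mul, ← neumann_C_mul, ← neumann_add, ← neumann_add]
  congr 1
  simp only [C_mul, C_neg, C_sub]
  ring

theorem pderiv_three_lumpEntry (a b : ℂ) (hab : a ≠ b) (k l : ℕ) :
    pderiv 3 (lumpEntry a b k l 0 0) = C a * (shiftN 1 (lumpSchur 1 a k) * lumpSchur (-1) b l)
      + C b * (lumpSchur 1 a k * shiftN (-1) (lumpSchur (-1) b l))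
      + C Complex.I * (C a ^ 2 - C b ^ 2) * lumpEntry a b k l 0 0 := by
  have h1 := lumpEntry_relation a b hab k l 1 0
  have h2 := lumpEntry_relation a b hab k l 0 (-1)
  rw [shiftN_zero] at h1 h2
  have h3 : pderiv 3 (lumpEntry a b k l 0 0)
      = -(C Complex.I * C a ^ 2) * (lumpEntry a b k l 2 0 - lumpEntry a b k l 0 0)
        + C Complex.I * C b ^ 2 * (lumpEntry a b k l 0 (-2) - lumpEntry a b k l 0 0) := by
    have e : ∀ x y : MvPolynomial (Fin 4) ℂ, x - y = x + C (-1) * y := by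
      intro x y; simp [sub_eq_add_neg]
    rw [e, e]
    simp only [lumpEntry, pderiv_neumann, ← C_mul, ← C_neg, ← C_pow, ← neumann_C_mul,
      ← neumann_add, shiftN_zero]
    rw [pderiv_mul, pderiv_three_lumpSchur _ _ (by norm_num),
      pderiv_three_lumpSchur _ _ (by norm_num)]
    congr 1
    simp only [C_mul, C_neg, C_pow, C_1, mul_one, mul_neg]
    ring
  rw [h3, ← h1, ← h2]
  norm_num
  ring

theorem pderiv_three_sub_two_lumpEntry (a b : ℂ) (ha : a ≠ 0) (hb : b ≠ 0) (hab : a ≠ b)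
    (k l : ℕ) :
    (pderiv 3 - pderiv 2 : Derivation ℂ (MvPolynomial (Fin 4) ℂ) (MvPolynomial (Fin 4) ℂ))
        (lumpEntry a b k l 0 0)
      = C a⁻¹ * C b⁻¹ * (shiftN (-1) (lumpSchur 1 a k) * shiftN 1 (lumpSchur (-1) b l))
      + C Complex.I * (C b⁻¹ - C a⁻¹) * lumpEntry a b k l 0 0 := by
  have h1 := lumpEntry_relation a b hab k l (-1) 1
  have hA : (C a : MvPolynomial (Fin 4) ℂ) * C a⁻¹ = 1 := by
    rw [← C_mul, mul_inv_cancel₀ ha, C_1]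
  have hB : (C b : MvPolynomial (Fin 4) ℂ) * C b⁻¹ = 1 := by
    rw [← C_mul, mul_inv_cancel₀ hb, C_1]
  have h3 : (pderiv 3 - pderiv 2 : Derivation ℂ (MvPolynomial (Fin 4) ℂ) (MvPolynomial (Fin 4) ℂ))
        (lumpEntry a b k l 0 0)
      = C Complex.I * C a⁻¹ * (lumpEntry a b k l (-1) 0 - lumpEntry a b k l 0 0)
        - C Complex.I * C b⁻¹ * (lumpEntry a b k l 0 1 - lumpEntry a b k l 0 0) := by
    have e : ∀ x y : MvPolynomial (Fin 4) ℂ, x - y = x + C (-1) * y := by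
      intro x y; simp [sub_eq_add_neg]
    rw [e, e, e, Derivation.sub_apply, e]
    simp only [lumpEntry, pderiv_neumann, ← C_mul, ← neumann_C_mul,
      ← neumann_add, shiftN_zero]
    congr 1
    have hP := pderiv_three_sub_two_lumpSchur 1 a (by norm_num) k
    have hQ := pderiv_three_sub_two_lumpSchur (-1) b (by norm_num) l
    rw [Derivation.sub_apply, sub_eq_iff_eq_add] at hP hQ
    rw [pderiv_mul, pderiv_mul, hP, hQ]
    simp only [C_mul, C_neg, C_1, one_mul, neg_neg]
    ring
  rw [h3, ← h1]
  norm_num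
  linear_combination (C Complex.I * C b⁻¹ * lumpEntry a b k l 0 1) * hA
    - (C Complex.I * C a⁻¹ * lumpEntry a b k l (-1) 0) * hB

theorem C_mul_lumpEntry_one_one (a b : ℂ) (hab : a ≠ b) (k l : ℕ) :
    C a * lumpEntry a b k l 1 1 = C b * lumpEntry a b k l 0 0
      + C Complex.I * (lumpSchur 1 a k * shiftN 1 (lumpSchur (-1) b l)) := by
  have h := lumpEntry_relation a b hab k l 0 1
  rw [shiftN_zero, zero_add, sub_self] at h
  rw [← h]
  linear_combination (-C a * lumpEntry a b k l 1 1 + C b * lumpEntry a b k l 0 0) * -C_I_mul_C_I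

theorem C_mul_lumpEntry_neg_one_neg_one (a b : ℂ) (hab : a ≠ b) (k l : ℕ) :
    C b * lumpEntry a b k l (-1) (-1) = C a * lumpEntry a b k l 0 0
      - C Complex.I * (shiftN (-1) (lumpSchur 1 a k) * lumpSchur (-1) b l) := by
  have h := lumpEntry_relation a b hab k l (-1) 0
  rw [shiftN_zero, neg_add_cancel, zero_sub] at h
  rw [← h]
  linear_combination
    (C a * lumpEntry a b k l 0 0 - C b * lumpEntry a b k l (-1) (-1)) * -C_I_mul_C_I

theorem shiftN_lumpEntry (a b : ℂ) (k l : ℕ) (s : ℂ) :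
    shiftN s (lumpEntry a b k l 0 0) = lumpEntry a b k l s s := by
  rw [lumpEntry, shiftN_neumann, map_mul, shiftN_comp, shiftN_comp, add_zero, lumpEntry]

end lumpMatrix

section lumpTau
open MvPolynomial Matrix

/-- The matrix of the determinant solution, as a matrix of polynomials in `(n, t, y, z)`. -/
noncomputable def lumpMatrix (a b : ℂ) {N : ℕ} (k : Fin N → ℕ) (s : ℂ) :
    Matrix (Fin N) (Fin N) (MvPolynomial (Fin 4) ℂ) :=
  Matrix.of fun i j => lumpEntry a b (k i) (k j) s s

theorem shiftN_det_lumpMatrix (a b : ℂ) {N : ℕ} (k : Fin N → ℕ) (s : ℂ) :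
    shiftN s (lumpMatrix a b k 0).det = (lumpMatrix a b k s).det := by
  rw [AlgHom.map_det]
  congr 1
  ext1 i j
  exact shiftN_lumpEntry a b (k i) (k j) s

theorem C_inv_mul_cancel {a : ℂ} (ha : a ≠ 0) :
    (C a⁻¹ : MvPolynomial (Fin 4) ℂ) * C a = 1 := by
  rw [← C_mul, inv_mul_cancel₀ ha, C_1]

theorem det_lumpMatrix_one (a b : ℂ) (ha : a ≠ 0) (hb : b ≠ 0) (hab : a ≠ b) {N : ℕ}
    (k : Fin N → ℕ) (h0 : (lumpMatrix a b k 0).det ≠ 0) :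
    shiftN 1 (lumpMatrix a b k 0).det = C ((b / a) ^ N) * ((lumpMatrix a b k 0).det
      + C Complex.I * C b⁻¹ * adjForm (lumpMatrix a b k 0) (fun i => lumpSchur 1 a (k i))
        (fun j => shiftN 1 (lumpSchur (-1) b (k j)))) := by
  rw [shiftN_det_lumpMatrix, ← adjForm_smul_left, ← det_add_vecMulVec_of_det_ne_zero _ h0]
  have h : lumpMatrix a b k 1 = (C (b / a) : MvPolynomial (Fin 4) ℂ) • (lumpMatrix a b k 0
      + vecMulVec
      ((C Complex.I * C b⁻¹ : MvPolynomial (Fin 4) ℂ) • fun i => lumpSchur 1 a (k i))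
      (fun j => shiftN 1 (lumpSchur (-1) b (k j)))) := by
    ext1 i j
    have h1 := C_mul_lumpEntry_one_one a b hab (k i) (k j)
    have h2 := C_inv_mul_cancel ha
    have h3 := C_inv_mul_cancel hb
    rw [div_eq_mul_inv, C_mul]
    simp only [lumpMatrix, Matrix.smul_apply, Matrix.add_apply, vecMulVec_apply, of_apply,
      Pi.smul_apply, smul_eq_mul]
    linear_combination C a⁻¹ * h1 - lumpEntry a b (k i) (k j) 1 1 * h2
      - C a⁻¹ * C Complex.I * (lumpSchur 1 a (k i) * shiftN 1 (lumpSchur (-1) b (k j))) * h3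
  rw [h, det_smul, Fintype.card_fin, C_pow]

theorem det_lumpMatrix_neg_one (a b : ℂ) (ha : a ≠ 0) (hb : b ≠ 0) (hab : a ≠ b) {N : ℕ}
    (k : Fin N → ℕ) (h0 : (lumpMatrix a b k 0).det ≠ 0) :
    shiftN (-1) (lumpMatrix a b k 0).det = C ((a / b) ^ N) * ((lumpMatrix a b k 0).det
      - C Complex.I * C a⁻¹ * adjForm (lumpMatrix a b k 0)
        (fun i => shiftN (-1) (lumpSchur 1 a (k i))) (fun j => lumpSchur (-1) b (k j))) := by
  rw [shiftN_det_lumpMatrix, sub_eq_add_neg, ← neg_mul, ← adjForm_smul_left,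
    ← det_add_vecMulVec_of_det_ne_zero _ h0]
  have h : lumpMatrix a b k (-1) = (C (a / b) : MvPolynomial (Fin 4) ℂ) • (lumpMatrix a b k 0
      + vecMulVec
      ((-(C Complex.I * C a⁻¹) : MvPolynomial (Fin 4) ℂ) •
        fun i => shiftN (-1) (lumpSchur 1 a (k i)))
      (fun j => lumpSchur (-1) b (k j))) := by
    ext1 i j
    have h1 := C_mul_lumpEntry_neg_one_neg_one a b hab (k i) (k j)
    have h2 := C_inv_mul_cancel ha
    have h3 := C_inv_mul_cancel hb
    rw [div_eq_mul_inv, C_mul]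
    simp only [lumpMatrix, Matrix.smul_apply, Matrix.add_apply, vecMulVec_apply, of_apply,
      Pi.smul_apply, smul_eq_mul]
    linear_combination C b⁻¹ * h1 - lumpEntry a b (k i) (k j) (-1) (-1) * h3
      + C b⁻¹ * C Complex.I * (shiftN (-1) (lumpSchur 1 a (k i)) * lumpSchur (-1) b (k j)) * h2
  rw [h, det_smul, Fintype.card_fin, C_pow]

theorem lumpMatrix_map_pderiv_one (a b : ℂ) (hab : a ≠ b) {N : ℕ} (k : Fin N → ℕ) :
    (lumpMatrix a b k 0).map (pderiv 1)
      = vecMulVec (fun i => lumpSchur 1 a (k i)) (fun j => lumpSchur (-1) b (k j))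
        + (C Complex.I * (C a - C b) : MvPolynomial (Fin 4) ℂ) • lumpMatrix a b k 0 := by
  ext1 i j
  exact pderiv_one_lumpEntry a b hab (k i) (k j)

theorem lumpTau_toda (a b : ℂ) (ha : a ≠ 0) (hb : b ≠ 0) (hab : a ≠ b) {N : ℕ}
    (k : Fin N → ℕ) (τ : MvPolynomial (Fin 4) ℂ) (hτ : τ = (lumpMatrix a b k 0).det) :
    (pderiv 1 (pderiv 3 τ) - pderiv 1 (pderiv 2 τ)) * τ - pderiv 1 τ * (pderiv 3 τ - pderiv 2 τ)
      = τ ^ 2 - shiftN 1 τ * shiftN (-1) τ := by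
  by_cases h0 : τ = 0
  · simp [h0]
  subst hτ
  have hA := C_inv_mul_cancel ha
  have hB := C_inv_mul_cancel hb
  have h := bilinear_toda_of_rank_one (pderiv 1) (pderiv 3 - pderiv 2) (lumpMatrix a b k 0)
    (C Complex.I) (C a) (C b) (C a⁻¹) (C b⁻¹) C_I_mul_C_I (by rw [mul_comm, hA])
    (by rw [mul_comm, hB]) (by simp)
    (fun i => lumpSchur 1 a (k i)) (fun i => shiftN (-1) (lumpSchur 1 a (k i)))
    (fun j => lumpSchur (-1) b (k j)) (fun j => shiftN 1 (lumpSchur (-1) b (k j)))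
    (lumpMatrix_map_pderiv_one a b hab k)
    (by
      ext1 i j
      exact pderiv_three_sub_two_lumpEntry a b ha hb hab (k i) (k j))
    (by
      ext1 i
      have h1 := pderiv_one_shiftN_lumpSchur_one a (-1) (k i)
      rwa [neg_add_cancel, shiftN_zero] at h1)
    (by
      ext1 j
      have h1 := pderiv_one_shiftN_lumpSchur_neg_one b 1 (k j)
      rwa [sub_self, shiftN_zero] at h1)
  have hκ : (C ((b / a) ^ N) : MvPolynomial (Fin 4) ℂ) * C ((a / b) ^ N) = 1 := by
    rw [← C_mul, ← mul_pow, div_mul_div_cancel₀ ha, div_self hb, one_pow, C_1]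
  rw [det_lumpMatrix_one a b ha hb hab k h0, det_lumpMatrix_neg_one a b ha hb hab k h0]
  rw [Derivation.sub_apply, map_sub] at h
  rw [h]
  linear_combination ((lumpMatrix a b k 0).det + C Complex.I * C b⁻¹ *
      adjForm (lumpMatrix a b k 0) (fun i => lumpSchur 1 a (k i))
        (fun j => shiftN 1 (lumpSchur (-1) b (k j))))
    * ((lumpMatrix a b k 0).det - C Complex.I * C a⁻¹ * adjForm (lumpMatrix a b k 0)
        (fun i => shiftN (-1) (lumpSchur 1 a (k i))) (fun j => lumpSchur (-1) b (k j))) * hκ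

theorem lumpTau_schrodinger (a b : ℂ) (ha : a ≠ 0) (hb : b ≠ 0) (hab : a ≠ b) {N : ℕ}
    (k : Fin N → ℕ) (τ : MvPolynomial (Fin 4) ℂ) (hτ : τ = (lumpMatrix a b k 0).det) :
    -C Complex.I * (pderiv 3 (shiftN 1 τ) * τ - shiftN 1 τ * pderiv 3 τ)
      = pderiv 1 (pderiv 1 (shiftN 1 τ)) * τ - 2 * pderiv 1 (shiftN 1 τ) * pderiv 1 τ
        + shiftN 1 τ * pderiv 1 (pderiv 1 τ) := by
  by_cases h0 : τ = 0
  · simp [h0]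
  subst hτ
  have hB := C_inv_mul_cancel hb
  refine bilinear_schrodinger_of_rank_one (pderiv 1) (pderiv 3) (lumpMatrix a b k 0) h0
    (C Complex.I) (C a) (C b) (C b⁻¹) (C ((b / a) ^ N)) C_I_mul_C_I (by rw [mul_comm, hB])
    (by simp) (by simp)
    (fun i => lumpSchur 1 a (k i)) (fun i => shiftN 1 (lumpSchur 1 a (k i)))
    (fun i => shiftN 2 (lumpSchur 1 a (k i)))
    (fun j => lumpSchur (-1) b (k j)) (fun j => shiftN (-1) (lumpSchur (-1) b (k j)))
    (fun j => shiftN 1 (lumpSchur (-1) b (k j)))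
    (lumpMatrix_map_pderiv_one a b hab k) ?_ ?_ ?_ ?_ ?_ ?_ ?_ _
    (det_lumpMatrix_one a b ha hb hab k h0)
  · ext1 i j
    exact pderiv_three_lumpEntry a b hab (k i) (k j)
  · ext1 i
    have h1 := pderiv_one_shiftN_lumpSchur_one a 0 (k i)
    rwa [zero_add, shiftN_zero] at h1
  · ext1 i
    have h1 := pderiv_one_shiftN_lumpSchur_one a 1 (k i)
    rwa [one_add_one_eq_two] at h1
  · ext1 j
    have h1 := pderiv_one_shiftN_lumpSchur_neg_one b 0 (k j)
    rwa [zero_sub, shiftN_zero] at h1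
  · ext1 j
    have h1 := pderiv_one_shiftN_lumpSchur_neg_one b 1 (k j)
    rwa [sub_self, shiftN_zero] at h1
  · ext1 i
    have h1 := pderiv_three_lumpSchur 1 a (by norm_num) (k i)
    simpa using h1
  · ext1 j
    have h1 := congrArg (shiftN 1) (pderiv_three_lumpSchur (-1) b (by norm_num) (k j))
    rw [← pderiv_shiftN _ _ (by decide), map_mul, map_sub, shiftN_comp] at h1
    rw [show (1 : ℂ) + 2 * -1 = -1 by norm_num] at h1
    simpa [shiftN] using h1

end lumpTau

section evaluation
open MvPolynomial

theorem schurRec_eq_schur (x : ℕ → ℂ) (k : ℕ) : schurRec x k = schur k x := by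
  induction k using Nat.strong_induction_on with
  | _ k ih =>
    obtain _ | k := k
    · rw [schurRec, schur_zero]
    · have h0 : (k : ℂ) + 1 ≠ 0 := by exact_mod_cast Nat.succ_ne_zero k
      apply mul_left_cancel₀ h0
      rw [succ_mul_schurRec_succ, schur_succ]
      refine Finset.sum_congr rfl fun j hj => ?_
      rw [ih _ (by have := Finset.mem_range.1 hj; omega)]

theorem schur_congr {x x' : ℕ → ℂ} (h : ∀ m, x (m + 1) = x' (m + 1)) (k : ℕ) :
    schur k x = schur k x' := by
  simp only [schur, h]

/-- The function of `(n, t, y, z)` defined by a polynomial. -/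
noncomputable def polyFun (f : MvPolynomial (Fin 4) ℂ) (n t y z : ℂ) : ℂ :=
  eval ![n, t, y, z] f

theorem hasDerivAt_eval_update (v : Fin 4 → ℂ) (j : Fin 4) (f : MvPolynomial (Fin 4) ℂ) (s : ℂ) :
    HasDerivAt (fun r => eval (Function.update v j r) f)
      (eval (Function.update v j s) (pderiv j f)) s := by
  induction f using MvPolynomial.induction_on with
  | C a => simpa using hasDerivAt_const s a
  | add f g hf hg =>
    simp only [map_add]
    exact hf.fun_add hg
  | mul_X f i hf =>
    have hX : HasDerivAt (fun r => eval (Function.update v j r) (X i))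
        (eval (Function.update v j s) (pderiv j (X i))) s := by
      by_cases hi : i = j
      · subst hi
        simp only [eval_X, Function.update_self, pderiv_X_self, map_one]
        exact hasDerivAt_id' s
      · simpa [hi, pderiv_X_of_ne hi] using hasDerivAt_const s (v i)
    simp only [pderiv_mul, map_add, map_mul]
    exact hf.fun_mul hX

theorem deriv_polyFun_one (f : MvPolynomial (Fin 4) ℂ) (n y z : ℂ) :
    deriv (fun s => polyFun f n s y z) = fun t => polyFun (pderiv 1 f) n t y z := by
  funext t
  have e : ∀ s, Function.update ![n, 0, y, z] 1 s = ![n, s, y, z] := by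
    intro s; ext i; fin_cases i <;> rfl
  have h := (hasDerivAt_eval_update ![n, 0, y, z] 1 f t).deriv
  simp only [e] at h
  exact h

theorem dT_polyFun (f : MvPolynomial (Fin 4) ℂ) : dT (polyFun f) = polyFun (pderiv 1 f) := by
  funext n t y z
  exact congrFun (deriv_polyFun_one f n y z) t

theorem dY_polyFun (f : MvPolynomial (Fin 4) ℂ) : dY (polyFun f) = polyFun (pderiv 2 f) := by
  funext n t y z
  have e : ∀ s, Function.update ![n, t, 0, z] 2 s = ![n, t, s, z] := by
    intro s; ext i; fin_cases i <;> rfl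
  have h := (hasDerivAt_eval_update ![n, t, 0, z] 2 f y).deriv
  simp only [e] at h
  exact h

theorem dZ_polyFun (f : MvPolynomial (Fin 4) ℂ) : dZ (polyFun f) = polyFun (pderiv 3 f) := by
  funext n t y z
  have e : ∀ s, Function.update ![n, t, y, 0] 3 s = ![n, t, y, s] := by
    intro s; ext i; fin_cases i <;> rfl
  have h := (hasDerivAt_eval_update ![n, t, y, 0] 3 f z).deriv
  simp only [e] at h
  exact h

theorem iteratedDeriv_polyFun (m : ℕ) (f : MvPolynomial (Fin 4) ℂ) (n t y z : ℂ) :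
    iteratedDeriv m (fun s => polyFun f n s y z) t = polyFun ((pderiv 1)^[m] f) n t y z := by
  induction m generalizing f with
  | zero => simp
  | succ m ih => rw [iteratedDeriv_succ', deriv_polyFun_one, ih, Function.iterate_succ_apply]

theorem polyFun_shiftN (s : ℂ) (f : MvPolynomial (Fin 4) ℂ) (n t y z : ℂ) :
    polyFun (shiftN s f) n t y z = polyFun f (n + s * Complex.I) t y z := by
  induction f using MvPolynomial.induction_on with
  | C a => simp [polyFun, shiftN]
  | add f g hf hg => simpa only [polyFun, map_add] using congrArg₂ (· + ·) hf hg
  | mul_X f i hf =>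
    have hX : polyFun (shiftN s (X i)) n t y z = polyFun (X i) (n + s * Complex.I) t y z := by
      fin_cases i <;> simp [polyFun, shiftN]
    simpa only [polyFun, map_mul] using congrArg₂ (· * ·) hf hX

theorem polyFun_lumpSchur (ε a : ℂ) (k : ℕ) (n t y z : ℂ) :
    polyFun (lumpSchur ε a k) n t y z = schur k (fun m => polyFun (lumpForm ε a m) n t y z) := by
  rw [← schurRec_eq_schur]
  exact map_schurRec (aeval ![n, t, y, z]) (lumpForm ε a) k

theorem iteratedDeriv_exp_combination (m : ℕ) (A B A' D w : ℂ) :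
    iteratedDeriv m (fun w => A + B * Complex.exp w + A' * Complex.exp (-w)
        + D * Complex.exp (2 * w)) w
      = (if m = 0 then A else 0) + B * Complex.exp w + A' * (-1) ^ m * Complex.exp (-w)
        + D * 2 ^ m * Complex.exp (2 * w) := by
  induction m generalizing A A' D with
  | zero => simp
  | succ m ih =>
    have h : deriv (fun w => A + B * Complex.exp w + A' * Complex.exp (-w)
        + D * Complex.exp (2 * w)) = fun w => 0 + B * Complex.exp w + (-A') * Complex.exp (-w)
        + (2 * D) * Complex.exp (2 * w) := by
      funext w
      have h1 := ((Complex.hasDerivAt_exp w).const_mul B).const_add A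
      have h2 := ((hasDerivAt_id w).neg.cexp).const_mul A'
      have h3 := (((hasDerivAt_id w).const_mul 2).cexp).const_mul D
      refine (((h1.add h2).add h3).deriv).trans ?_
      simp
      ring
    rw [iteratedDeriv_succ', h, ih]
    simp only [ite_self, Nat.succ_ne_zero, if_false, pow_succ]
    ring

theorem polyFun_lumpForm (ε p : ℂ) (m : ℕ) (n t y z : ℂ) :
    polyFun (lumpForm ε (Complex.exp p) (m + 1)) n t y z
      = (1 / (Nat.factorial (m + 1) : ℂ)) * iteratedDeriv m (fun w => ε * (-Complex.I * n
          - Complex.I * Complex.exp w * t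
          + Complex.I * (Complex.exp (-w) - 2 * Complex.exp (2 * w)) * y
          - 2 * Complex.I * Complex.exp (2 * w) * z)) p := by
  have h : (fun w => ε * (-Complex.I * n - Complex.I * Complex.exp w * t
      + Complex.I * (Complex.exp (-w) - 2 * Complex.exp (2 * w)) * y
      - 2 * Complex.I * Complex.exp (2 * w) * z))
      = fun w => -(ε * Complex.I * n) + (-(ε * Complex.I * t)) * Complex.exp w
        + (ε * Complex.I * y) * Complex.exp (-w)
        + (-2 * ε * Complex.I * (y + z)) * Complex.exp (2 * w) := by
    funext w; ring
  rw [h, iteratedDeriv_exp_combination, two_mul p, Complex.exp_add, Complex.exp_neg]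
  rcases Nat.eq_zero_or_pos m with rfl | hm
  · simp [polyFun, lumpForm]
    ring
  · simp [polyFun, lumpForm, hm.ne', pow_succ]
    ring

end evaluation

section lumpTauFun
open MvPolynomial

theorem variantBS_polyFun_det_lumpMatrix (a b : ℂ) (ha : a ≠ 0) (hb : b ≠ 0) (hab : a ≠ b)
    {N : ℕ} (k : Fin N → ℕ) : VariantBS (polyFun (lumpMatrix a b k 0).det) := by
  generalize hτ : (lumpMatrix a b k 0).det = τ
  intro n t y z
  have hp : ∀ f, polyFun (shiftN 1 f) n t y z = polyFun f (n + Complex.I) t y z := by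
    intro f
    rw [polyFun_shiftN, one_mul]
  have hm : ∀ f, polyFun (shiftN (-1) f) n t y z = polyFun f (n - Complex.I) t y z := by
    intro f
    rw [polyFun_shiftN, neg_one_mul, ← sub_eq_add_neg]
  simp only [dT_polyFun, dY_polyFun, dZ_polyFun, ← hp, ← hm,
    ← pderiv_shiftN 1 1 (by decide), ← pderiv_shiftN 1 3 (by decide)]
  constructor
  · have h := congrArg (eval ![n, t, y, z]) (lumpTau_schrodinger a b ha hb hab k τ hτ.symm)
    simp only [map_mul, map_sub, map_add, map_neg, map_ofNat, eval_C] at h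
    exact h
  · have h := congrArg (eval ![n, t, y, z]) (lumpTau_toda a b ha hb hab k τ hτ.symm)
    simp only [map_mul, map_sub, map_pow] at h
    exact h

theorem polyFun_det_lumpMatrix (a b : ℂ) {N : ℕ} (k : Fin N → ℕ) (n t y z : ℂ) :
    polyFun (lumpMatrix a b k 0).det n t y z = Matrix.det (Matrix.of fun i j : Fin N =>
      ∑ σ ∈ Finset.range (k i + k j + 1),
        (-1 : ℂ) ^ σ / (-Complex.I * a + Complex.I * b) ^ (σ + 1)
          * iteratedDeriv σ (fun s => polyFun (lumpSchur 1 a (k i)) n s y z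
            * polyFun (lumpSchur (-1) b (k j)) n s y z) t) := by
  rw [polyFun, RingHom.map_det]
  congr 1
  ext i j
  have h : ∀ s, polyFun (lumpSchur 1 a (k i)) n s y z * polyFun (lumpSchur (-1) b (k j)) n s y z
      = polyFun (lumpSchur 1 a (k i) * lumpSchur (-1) b (k j)) n s y z :=
    fun s => (map_mul (eval ![n, s, y, z]) _ _).symm
  simp only [RingHom.mapMatrix_apply, Matrix.map_apply, Matrix.of_apply, h, iteratedDeriv_polyFun]
  simp only [lumpMatrix, Matrix.of_apply, lumpEntry, neumann, map_sum, map_mul, eval_C,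
    shiftN_zero, polyFun]

end lumpTauFun

/-- the determinant built from the Schur-polynomial functions
`P_{k_i}`, `Q_{k_j}` via `m_{ij} = ∑_{σ=0}^{k_i+k_j} (−1)^σ/(−ie^p+ie^q)^{σ+1}
∂_t^σ(P_{k_i} Q_{k_j})` solves the variant bilinear Blaszak–Szum system, giving the
rational (lump) solutions `u = τ(n+i)τ(n−i)/τ(n)²`. -/
theorem schur_lump_tau_solves_variantBS (p q : ℂ) (hpq : Complex.exp p ≠ Complex.exp q)
    (N : ℕ) (hN : 1 ≤ N) (k : Fin N → ℕ) (hk : ∀ i, 1 ≤ k i)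
    (μ ν : ℕ → ℂ → ℂ → ℂ → ℂ → ℂ)
    (hμ : ∀ (j : ℕ) (n t y z : ℂ), μ j n t y z
      = (1 / (Nat.factorial j : ℂ)) *
          iteratedDeriv (j - 1)
            (fun p' => -Complex.I * n - Complex.I * Complex.exp p' * t
              + Complex.I * (Complex.exp (-p') - 2 * Complex.exp (2 * p')) * y
              - 2 * Complex.I * Complex.exp (2 * p') * z) p)
    (hν : ∀ (j : ℕ) (n t y z : ℂ), ν j n t y z
      = (1 / (Nat.factorial j : ℂ)) *
          iteratedDeriv (j - 1)
            (fun q' => Complex.I * n + Complex.I * Complex.exp q' * t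
              - Complex.I * (Complex.exp (-q') - 2 * Complex.exp (2 * q')) * y
              + 2 * Complex.I * Complex.exp (2 * q') * z) q)
    (P Q : ℕ → ℂ → ℂ → ℂ → ℂ → ℂ)
    (hP : ∀ (j : ℕ) (n t y z : ℂ), P j n t y z = schur j (fun m => μ m n t y z))
    (hQ : ∀ (j : ℕ) (n t y z : ℂ), Q j n t y z = schur j (fun m => ν m n t y z)) :
    VariantBS (fun n t y z =>
      Matrix.det (Matrix.of (fun i j : Fin N =>
        ∑ σ ∈ Finset.range (k i + k j + 1),
          (-1 : ℂ) ^ σ / (-Complex.I * Complex.exp p + Complex.I * Complex.exp q) ^ (σ + 1)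
            * iteratedDeriv σ (fun s => P (k i) n s y z * Q (k j) n s y z) t))) := by
  have hP' : ∀ (l : ℕ) (n t y z : ℂ),
      P l n t y z = polyFun (lumpSchur 1 (Complex.exp p) l) n t y z := by
    intro l n t y z
    rw [hP, polyFun_lumpSchur]
    refine schur_congr (fun m => ?_) l
    rw [hμ, polyFun_lumpForm, Nat.add_sub_cancel]
    simp only [one_mul]
  have hQ' : ∀ (l : ℕ) (n t y z : ℂ),
      Q l n t y z = polyFun (lumpSchur (-1) (Complex.exp q) l) n t y z := by
    intro l n t y z
    rw [hQ, polyFun_lumpSchur]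
    refine schur_congr (fun m => ?_) l
    rw [hν, polyFun_lumpForm, Nat.add_sub_cancel]
    congr 2
    funext w
    ring
  simp only [hP', hQ', ← polyFun_det_lumpMatrix]
  exact variantBS_polyFun_det_lumpMatrix _ _ (Complex.exp_ne_zero p) (Complex.exp_ne_zero q) hpq k
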